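/- Let φ=(1+√5)/2 be the golden ratio. For all positive integers a, b, with R=R(a,b)=(a+√(a²+4b))/2, one has R/(R−1)² ≤ 2φ+1, with equality if and only if a=b=1. Consequently, among all distributions induced by second-order linear recurrences with positive integer coefficients, the limiting variance lim_{N→∞} Var(X̲_N) = R/(R−1)² (which equals lim_{N→∞} Var(X̄_N)) is maximal exactly for the classical Fibonacci sequence (a=b=1), where it equals 2φ+1. -/

import Mathlib

open Filter Finset

/-- For all positive integers `a, b`, with `R(a,b) = (a + √(a²+4b))/2`, one has
`R/(R-1)² ≤ 2φ + 1`, with equality iff `a = b = 1`; hence the limiting variance is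
maximal exactly for the classical Fibonacci sequence, where it equals `2φ + 1`. -/
theorem stmt_6 (φ : ℝ) (hφ : φ = (1 + Real.sqrt 5) / 2)
    (R : ℕ → ℕ → ℝ)
    (hR : ∀ a b : ℕ, R a b = ((a : ℝ) + Real.sqrt ((a : ℝ) ^ 2 + 4 * (b : ℝ))) / 2) :
    (∀ a b : ℕ, 0 < a → 0 < b →
      R a b / (R a b - 1) ^ 2 ≤ 2 * φ + 1 ∧
      (R a b / (R a b - 1) ^ 2 = 2 * φ + 1 ↔ a = 1 ∧ b = 1)) ∧
    R 1 1 / (R 1 1 - 1) ^ 2 = 2 * φ + 1 := by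
  have h5 : Real.sqrt 5 ^ 2 = 5 := Real.sq_sqrt (by norm_num)
  have h5p : 0 ≤ Real.sqrt 5 := Real.sqrt_nonneg 5
  have hφ1 : 1 < φ := by rw [hφ]; nlinarith
  have hφ2 : φ ^ 2 = φ + 1 := by rw [hφ]; nlinarith
  have h11 : R 1 1 = φ := by
    rw [hR, hφ]; norm_num
  have hE : R 1 1 / (R 1 1 - 1) ^ 2 = 2 * φ + 1 := by
    rw [h11, div_eq_iff (by have : 0 < φ - 1 := by linarith
                            positivity)]
    have h3 : φ ^ 3 = 2 * φ + 1 := by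
      linear_combination (φ + 1) * hφ2
    linear_combination (-2) * h3 + 3 * hφ2
  refine ⟨fun a b ha hb => ?_, hE⟩
  by_cases h : a = 1 ∧ b = 1
  · obtain ⟨rfl, rfl⟩ := h
    exact ⟨hE.le, by simp [hE]⟩
  have hlt : φ < R a b := by
    have ha' : (1 : ℝ) ≤ a := by exact_mod_cast ha
    have hn : 5 < a ^ 2 + 4 * b := by
      by_contra hc
      exact h ⟨by nlinarith, by nlinarith⟩
    have hn' : (5 : ℝ) < (a : ℝ) ^ 2 + 4 * b := by exact_mod_cast hn
    have := Real.sqrt_lt_sqrt (by norm_num) hn'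
    rw [hR, hφ]; linarith
  have hs : R a b / (R a b - 1) ^ 2 < 2 * φ + 1 := by
    generalize R a b = r at hlt
    have h1 : 0 < r - 1 := by linarith
    rw [div_lt_iff₀ (by positivity)]
    have hk : (2 * φ + 1) * (r - 1) ^ 2 - r = (2 * φ + 1) * ((r - φ) * (r - φ + 1)) := by
      linear_combination (4 * r - 2 * φ - 1) * hφ2
    have : 0 < (2 * φ + 1) * ((r - φ) * (r - φ + 1)) := by
      have : 0 < r - φ := by linarith
      positivity
    linarith
  exact ⟨hs.le, ⟨fun he => absurd he hs.ne, fun he => absurd he h⟩⟩
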